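/- Let G be a finite group acting effectively by homeomorphisms on the 2-torus T², such that every element of G acts by a homeomorphism homotopic to the identity map. Then there exist positive integers p and q such that G is isomorphic to ℤ/p × ℤ/q. -/

import Mathlib

/-- The 2-torus `(ℝ/ℤ) × (ℝ/ℤ)`. -/
abbrev Torus2 : Type := AddCircle (1 : ℝ) × AddCircle (1 : ℝ)

/-- The group of self-homeomorphisms of a topological space, with `(f * g) x = f (g x)`. -/
instance homeomorphGroup {X : Type*} [TopologicalSpace X] : Group (X ≃ₜ X) where
  mul f g := g.trans f
  one := Homeomorph.refl X
  inv := Homeomorph.symm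
  mul_assoc _ _ _ := rfl
  one_mul f := Homeomorph.ext fun _ => rfl
  mul_one f := Homeomorph.ext fun _ => rfl
  inv_mul_cancel := Homeomorph.self_trans_symm

open Complex Set Metric

/-- Tietze extension for complex-valued functions continuous on a closed set. -/
theorem ContinuousOn.exists_continuous_extension {X : Type*} [TopologicalSpace X] [NormalSpace X]
    {s : Set X} (hs : IsClosed s) {f : X → ℂ} (hf : ContinuousOn f s) :
    ∃ F : X → ℂ, Continuous F ∧ EqOn F f s := by
  obtain ⟨F, hF⟩ := ContinuousMap.exists_restrict_eq hs
    ⟨s.domRestrict f, continuousOn_iff_continuous_domRestrict.mp hf⟩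
  exact ⟨F, F.continuous, fun x hx => DFunLike.congr_fun hF ⟨x, hx⟩⟩

/-- A nonvanishing continuous function on a compact set of reals has a continuous logarithm. -/
theorem exists_continuousOn_log_of_compact_real {L : Set ℝ} (hL : IsCompact L) {g : ℝ → ℂ}
    (hg : ContinuousOn g L) (hg0 : ∀ x ∈ L, g x ≠ 0) :
    ∃ s : ℝ → ℂ, ContinuousOn s L ∧ ∀ x ∈ L, exp (s x) = g x := by
  obtain ⟨a, b, hab⟩ : ∃ a b : ℝ, L ⊆ Icc a b := by
    obtain ⟨R, hR⟩ := hL.isBounded.subset_closedBall 0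
    exact ⟨_, _, hR.trans (Real.closedBall_eq_Icc).subset⟩
  obtain ⟨δ, hδ, hδg⟩ : ∃ δ > 0, ∀ x ∈ L, ∀ y ∈ L, dist x y < δ → g y / g x ∈ slitPlane := by
    obtain ⟨m, hm, hmg⟩ : ∃ m > 0, ∀ x ∈ L, m ≤ ‖g x‖ := by
      rcases L.eq_empty_or_nonempty with rfl | hne
      · exact ⟨1, one_pos, by simp⟩
      · obtain ⟨x, hx, h⟩ := hL.exists_isMinOn hne hg.norm
        exact ⟨_, norm_pos_iff.mpr (hg0 x hx), fun y hy => h hy⟩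
    obtain ⟨δ, hδ, h⟩ := Metric.uniformContinuousOn_iff.mp
      (hL.uniformContinuousOn_of_continuous hg) m hm
    refine ⟨δ, hδ, fun x hx y hy hxy => ?_⟩
    have h1 := h x hx y hy hxy
    have h2 : ‖g y / g x - 1‖ < 1 := by
      rw [div_sub_one (hg0 x hx), norm_div, div_lt_one (norm_pos_iff.mpr (hg0 x hx)),
        ← dist_eq_norm, dist_comm]
      exact h1.trans_le (hmg x hx)
    have := mem_slitPlane_of_norm_lt_one h2
    simpa using this
  have key : ∀ n : ℕ, ∃ s : ℝ → ℂ, ContinuousOn s (L ∩ Iic (a + n * (δ / 2))) ∧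
      ∀ x ∈ L ∩ Iic (a + n * (δ / 2)), exp (s x) = g x := by
    intro n
    induction n with
    | zero =>
      refine ⟨fun x => log (g a), continuousOn_const, fun x hx => ?_⟩
      have hxa : x = a := le_antisymm (by simpa using hx.2) (hab hx.1).1
      subst hxa
      exact exp_log (hg0 _ hx.1)
    | succ n ih =>
      obtain ⟨s, hs, hsg⟩ := ih
      set c := a + n * (δ / 2) with hc
      have hc' : a + (n + 1 : ℕ) * (δ / 2) = c + δ / 2 := by push_cast; ring
      rw [hc']
      obtain ⟨t, ht, htg, hts⟩ : ∃ t : ℝ → ℂ, ContinuousOn t (L ∩ Icc c (c + δ / 2)) ∧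
          (∀ x ∈ L ∩ Icc c (c + δ / 2), exp (t x) = g x) ∧ (c ∈ L → t c = s c) := by
        obtain ⟨x₀, u, hx₀, hu, hus⟩ : ∃ (x₀ : ℝ) (u : ℂ),
            (L ∩ Icc c (c + δ / 2) ⊆ {x | x₀ ∈ L ∩ Icc c (c + δ / 2)}) ∧
            (L ∩ Icc c (c + δ / 2) ⊆ {x | exp u = g x₀}) ∧ (c ∈ L → x₀ = c ∧ u = s c) := by
          by_cases hcL : c ∈ L
          · exact ⟨c, s c, fun x hx => ⟨hcL, by simp; positivity⟩,
              fun x hx => hsg c ⟨hcL, by simp⟩, fun _ => ⟨rfl, rfl⟩⟩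
          · rcases (L ∩ Icc c (c + δ / 2)).eq_empty_or_nonempty with h | ⟨y, hy⟩
            · exact ⟨0, 0, by simp [h], by simp [h], fun h => absurd h hcL⟩
            · exact ⟨y, log (g y), fun _ _ => hy, fun _ _ => exp_log (hg0 y hy.1),
                fun h => absurd h hcL⟩
        have hslit : ∀ x ∈ L ∩ Icc c (c + δ / 2), g x / g x₀ ∈ slitPlane := by
          intro x hx
          have h0 := hx₀ hx
          refine hδg x₀ h0.1 x hx.1 ?_
          rw [Real.dist_eq, abs_lt]
          have h1 := hx.2.1
          have h2 := hx.2.2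
          have h3 := h0.2.1
          have h4 := h0.2.2
          constructor <;> linarith
        refine ⟨fun x => u + log (g x / g x₀), ?_, fun x hx => ?_, fun hcL => ?_⟩
        · exact continuousOn_const.add
            (((hg.mono inter_subset_left).div_const _).clog hslit)
        · have h0 : g x₀ ≠ 0 := hg0 _ (hx₀ hx).1
          rw [exp_add, hu hx, exp_log (slitPlane_ne_zero (hslit x hx)), mul_div_cancel₀ _ h0]
        · obtain ⟨h1, h2⟩ := hus hcL
          simp [h1, h2, div_self (hg0 c hcL)]
      have hLc : IsClosed L := hL.isClosed
      have e1 : EqOn (fun x => if x ≤ c then s x else t x) s (L ∩ Iic c) :=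
        fun x hx => if_pos hx.2
      have e2 : EqOn (fun x => if x ≤ c then s x else t x) t (L ∩ Icc c (c + δ / 2)) := by
        intro x hx
        by_cases h : x ≤ c
        · have : x = c := le_antisymm h hx.2.1
          subst this
          simp [hts hx.1]
        · simp [h]
      have hun : L ∩ Iic (c + δ / 2) = (L ∩ Iic c) ∪ (L ∩ Icc c (c + δ / 2)) := by
        rw [← inter_union_distrib_left, Iic_union_Icc_eq_Iic (by linarith)]
      refine ⟨fun x => if x ≤ c then s x else t x, ?_, ?_⟩
      · rw [hun]
        exact (hs.congr e1).union_of_isClosed (ht.congr e2) (hLc.inter isClosed_Iic)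
          (hLc.inter isClosed_Icc)
      · rw [hun]
        rintro x (hx | hx)
        · rw [e1 hx, hsg x hx]
        · rw [e2 hx, htg x hx]
  obtain ⟨n, hn⟩ := exists_nat_gt ((b - a) / (δ / 2))
  obtain ⟨s, hs, hsg⟩ := key n
  have hsub : L ∩ Iic (a + n * (δ / 2)) = L := by
    refine inter_eq_left.mpr fun x hx => ?_
    have := (hab hx).2
    rw [div_lt_iff₀ (by positivity)] at hn
    simp only [mem_Iic]
    linarith
  rw [hsub] at hs hsg
  exact ⟨s, hs, hsg⟩

/-- A nonvanishing continuous function on a closed subset of a circle is, up to an integral power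
of the coordinate centred at the centre of the circle, an exponential. -/
theorem exists_zpow_mul_exp_of_subset_sphere {b : ℂ} {r : ℝ} (hr : 0 < r) {L : Set ℂ}
    (hL : IsClosed L) (hLs : L ⊆ sphere b r) {g : ℂ → ℂ} (hg : ContinuousOn g L)
    (hg0 : ∀ z ∈ L, g z ≠ 0) :
    ∃ (k : ℤ) (σ : ℂ → ℂ), Continuous σ ∧ ∀ z ∈ L, g z = (z - b) ^ k * exp (σ z) := by
  classical
  wlog h0 : circleMap b r 0 ∈ L generalizing L g
  · set q := circleMap b r 0
    have hu : ContinuousOn (fun z => if z = q then 1 else g z) L :=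
      hg.congr fun z hz => if_neg (ne_of_mem_of_not_mem hz h0)
    obtain ⟨k, σ, hσ, h⟩ := this (L := L ∪ {q}) (g := fun z => if z = q then 1 else g z)
      (hL.union isClosed_singleton)
      (union_subset hLs (singleton_subset_iff.mpr (circleMap_mem_sphere b hr.le 0)))
      (hu.union_of_isClosed (continuousOn_singleton _ _) hL isClosed_singleton)
      (by
        rintro z (hz | hz)
        · have : z ≠ q := fun h => h0 (h ▸ hz)
          simp [this, hg0 z hz]
        · simp only [mem_singleton_iff] at hz
          simp [hz])
      (Or.inr rfl)
    refine ⟨k, σ, hσ, fun z hz => ?_⟩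
    rw [← h z (Or.inl hz), if_neg (ne_of_mem_of_not_mem hz h0)]
  set c : ℝ → ℂ := circleMap b r with hc
  have hcc : Continuous c := continuous_circleMap b r
  set M : Set ℝ := Icc 0 (2 * Real.pi) ∩ c ⁻¹' L with hM
  have hMc : IsCompact M := isCompact_Icc.inter_right (hL.preimage hcc)
  have hML : MapsTo c M L := fun x hx => hx.2
  have hpi := Real.pi_pos
  have h2pi : c (2 * Real.pi) = c 0 := by
    simpa using (periodic_circleMap b r) 0
  obtain ⟨s, hs, hsg⟩ := exists_continuousOn_log_of_compact_real hMc
    (hg.comp hcc.continuousOn hML) (fun x hx => hg0 _ (hML hx))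
  have m0 : (0 : ℝ) ∈ M := ⟨by constructor <;> linarith, h0⟩
  have m1 : 2 * Real.pi ∈ M := ⟨by constructor <;> linarith, by simpa [h2pi] using h0⟩
  obtain ⟨k, hk⟩ : ∃ k : ℤ, s (2 * Real.pi) = s 0 + k * (2 * Real.pi * I) := by
    rw [← exp_eq_exp_iff_exists_int, hsg _ m0, hsg _ m1]
    simp [h2pi]
  set t : ℝ → ℂ := fun x => s x - k * (x * I) - k * Real.log r with ht
  have htc : ContinuousOn t M := by
    refine (hs.sub (Continuous.continuousOn ?_)).sub continuousOn_const
    fun_prop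
  have htg : ∀ x ∈ M, g (c x) = (c x - b) ^ k * exp (t x) := by
    intro x hx
    have e1 : c x - b = exp (Real.log r + x * I) := by
      rw [exp_add, ← ofReal_exp, Real.exp_log hr]
      simp [hc, circleMap]
    rw [e1, ← exp_int_mul, ← exp_add, show g (c x) = exp (s x) from (hsg x hx).symm]
    congr 1
    simp only [ht]
    ring
  have ht01 : t (2 * Real.pi) = t 0 := by
    simp only [ht, hk]
    push_cast
    ring
  have hsurj : ∀ z ∈ L, ∃ x ∈ M, 0 < x ∧ c x = z := by
    intro z hz
    have hz' := hLs hz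
    rw [← abs_of_pos hr, ← image_circleMap_Ioc] at hz'
    obtain ⟨x, hx, rfl⟩ := hz'
    exact ⟨x, ⟨Ioc_subset_Icc_self hx, hz⟩, hx.1, rfl⟩
  choose! θ hθM hθpos hθc using hsurj
  have hτ : ∀ x ∈ M, t (θ (c x)) = t x := by
    intro x hx
    have inj := injOn_circleMap_of_abs_sub_le (c := b) hr.ne' (a := 0) (b := 2 * Real.pi)
      (by simp [abs_of_pos hpi])
    rw [uIoc_of_le (by positivity)] at inj
    have hmem : θ (c x) ∈ Ioc 0 (2 * Real.pi) :=
      ⟨hθpos _ (hML hx), (hθM _ (hML hx)).1.2⟩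
    have heq := hθc (c x) (hML hx)
    rcases hx.1.1.eq_or_lt with rfl | hx0
    · rw [inj hmem ⟨by positivity, le_rfl⟩ (heq.trans h2pi.symm), ht01]
    · rw [inj hmem ⟨hx0, hx.1.2⟩ heq]
  have hσc : ContinuousOn (fun z => t (θ z)) L := by
    have : CompactSpace M := isCompact_iff_compactSpace.mp hMc
    have hq : Topology.IsQuotientMap (hML.restrict) :=
      (Continuous.isClosedMap (hcc.continuousOn.mapsToRestrict hML)).isQuotientMap
        (hcc.continuousOn.mapsToRestrict hML)
        (fun z => ⟨⟨θ z, hθM z z.2⟩, Subtype.ext (hθc z z.2)⟩)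
    rw [continuousOn_iff_continuous_domRestrict, hq.continuous_iff]
    have : (L.domRestrict fun z => t (θ z)) ∘ hML.restrict = M.domRestrict t := by
      ext x
      exact hτ x x.2
    rw [this]
    exact continuousOn_iff_continuous_domRestrict.mp htc
  obtain ⟨σ, hσ, hσe⟩ := hσc.exists_continuous_extension hL
  refine ⟨k, σ, hσ, fun z hz => ?_⟩
  have := htg (θ z) (hθM z hz)
  rwa [hθc z hz, ← show σ z = t (θ z) from hσe hz] at this

/-- The function `g` behaves near infinity like `z ^ n` up to a continuous exponential factor, i.e.
it has winding number `n` around large circles. -/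
def HasWindingAtInfinity (g : ℂ → ℂ) (n : ℤ) : Prop :=
  ∃ R : ℝ, 0 < R ∧ ∃ σ : ℂ → ℂ, ContinuousOn σ {z | R ≤ ‖z‖} ∧
    ∀ z, R ≤ ‖z‖ → g z = z ^ n * exp (σ z)

namespace HasWindingAtInfinity

theorem mul {g h : ℂ → ℂ} {m n : ℤ} (hg : HasWindingAtInfinity g m)
    (hh : HasWindingAtInfinity h n) : HasWindingAtInfinity (fun z => g z * h z) (m + n) := by
  obtain ⟨R, hR, σ, hσ, hgσ⟩ := hg
  obtain ⟨S, hS, τ, hτ, hhτ⟩ := hh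
  refine ⟨max R S, lt_max_of_lt_left hR, fun z => σ z + τ z,
    (hσ.mono fun z hz => (le_max_left R S).trans hz).add
      (hτ.mono fun z hz => (le_max_right R S).trans hz), fun z hz => ?_⟩
  have hz0 : z ≠ 0 := norm_pos_iff.mp ((lt_max_of_lt_left hR).trans_le hz)
  beta_reduce
  rw [hgσ z ((le_max_left R S).trans hz), hhτ z ((le_max_right R S).trans hz), zpow_add₀ hz0,
    exp_add]
  ring

theorem zpow {g : ℂ → ℂ} {m : ℤ} (hg : HasWindingAtInfinity g m) (k : ℤ) :
    HasWindingAtInfinity (fun z => g z ^ k) (m * k) := by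
  obtain ⟨R, hR, σ, hσ, hgσ⟩ := hg
  refine ⟨R, hR, fun z => k * σ z, continuousOn_const.mul hσ, fun z hz => ?_⟩
  beta_reduce
  rw [hgσ z hz, mul_zpow, zpow_mul, exp_int_mul]

theorem prod {ι : Type*} (s : Finset ι) {g : ι → ℂ → ℂ} {n : ℤ}
    (hg : ∀ i ∈ s, HasWindingAtInfinity (g i) n) :
    HasWindingAtInfinity (fun z => ∏ i ∈ s, g i z) (s.card * n) := by
  classical
  induction s using Finset.induction_on with
  | empty => exact ⟨1, one_pos, 0, continuousOn_const, by simp⟩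
  | insert i s hi ih =>
    simp only [Finset.prod_insert hi, Finset.card_insert_of_notMem hi]
    have := (hg i (Finset.mem_insert_self i s)).mul
      (ih fun j hj => hg j (Finset.mem_insert_of_mem hj))
    convert! this using 1
    push_cast
    ring

theorem congr {g h : ℂ → ℂ} {n : ℤ} (hg : HasWindingAtInfinity g n) (S : ℝ)
    (hS : ∀ z, S ≤ ‖z‖ → h z = g z) : HasWindingAtInfinity h n := by
  obtain ⟨R, hR, σ, hσ, hgσ⟩ := hg
  exact ⟨max R S, lt_max_of_lt_left hR, σ, hσ.mono fun z hz => (le_max_left R S).trans hz,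
    fun z hz => (hS z ((le_max_right R S).trans hz)).trans (hgσ z ((le_max_left R S).trans hz))⟩

/-- A continuous map at bounded distance from the identity has winding number one at infinity. -/
theorem of_norm_sub_le {g : ℂ → ℂ} (hg : Continuous g) {D : ℝ} (hD : ∀ z, ‖g z - z‖ ≤ D) :
    HasWindingAtInfinity g 1 := by
  have hD0 : 0 ≤ D := (norm_nonneg _).trans (hD 0)
  have hpos : ∀ z : ℂ, D + 1 ≤ ‖z‖ → 0 < ‖z‖ := fun z hz => by linarith
  have hslit : ∀ z : ℂ, D + 1 ≤ ‖z‖ → g z / z ∈ slitPlane := by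
    intro z hz
    have hz0 : z ≠ 0 := norm_pos_iff.mp (hpos z hz)
    have : ‖g z / z - 1‖ < 1 := by
      rw [div_sub_one hz0, norm_div, div_lt_one (hpos z hz)]
      linarith [hD z]
    simpa using mem_slitPlane_of_norm_lt_one this
  refine ⟨D + 1, by positivity, fun z => log (g z / z), ?_, fun z hz => ?_⟩
  · exact (hg.continuousOn.div continuousOn_id
      fun z hz => norm_pos_iff.mp (hpos z hz)).clog hslit
  · rw [exp_log (slitPlane_ne_zero (hslit z hz)), zpow_one,
      mul_div_cancel₀ _ (norm_pos_iff.mp (hpos z hz))]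

/-- A nowhere vanishing continuous function on the plane has winding number zero at infinity. -/
theorem eq_zero_of_forall_ne_zero {g : ℂ → ℂ} {n : ℤ} (h : HasWindingAtInfinity g n)
    (hg : Continuous g) (hg0 : ∀ z, g z ≠ 0) : n = 0 := by
  obtain ⟨R, hR, σ, hσ, hgσ⟩ := h
  obtain ⟨ℓ, ⟨-, hℓ⟩, -⟩ := isCoveringMapOn_exp.existsUnique_continuousMap_lifts ⟨g, hg⟩
    (a₀ := 0) (exp_log (hg0 0)) hg0
  have hnorm : ∀ x : ℝ, ‖circleMap 0 R x‖ = R := fun x => by simp [abs_of_pos hR]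
  set F : ℝ → ℂ := fun x =>
    ℓ (circleMap 0 R x) - σ (circleMap 0 R x) - n * (Real.log R + x * I) with hF
  have hFc : Continuous F := by
    have h1 : Continuous fun x => σ (circleMap 0 R x) :=
      hσ.comp_continuous (continuous_circleMap 0 R) fun x => (hnorm x).ge
    have h2 : Continuous fun x => ℓ (circleMap 0 R x) :=
      ℓ.continuous.comp (continuous_circleMap 0 R)
    exact (h2.sub h1).sub (by fun_prop)
  have hF1 : ∀ x, exp (F x) = 1 := by
    intro x
    have e1 : circleMap 0 R x = exp (Real.log R + x * I) := by
      rw [exp_add, ← ofReal_exp, Real.exp_log hR]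
      simp [circleMap]
    have e2 : exp (ℓ (circleMap 0 R x)) = g (circleMap 0 R x) := congr_fun hℓ _
    simp only [hF]
    rw [sub_sub, exp_sub, e2, hgσ _ (hnorm x).ge, exp_add, exp_int_mul, ← e1, mul_comm,
      div_self]
    exact mul_ne_zero (exp_ne_zero _)
      (zpow_ne_zero _ (norm_pos_iff.mp (by rw [hnorm]; exact hR)))
  have hconst : F = fun _ => F 0 :=
    isCoveringMap_exp.eq_of_comp_eq hFc continuous_const
      (funext fun x => Subtype.ext ((hF1 x).trans (hF1 0).symm)) 0 rfl
  have h2 : F (2 * Real.pi) = F 0 := congr_fun hconst _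
  have h3 : circleMap 0 R (2 * Real.pi) = circleMap 0 R 0 := by
    simpa using (periodic_circleMap 0 R) 0
  have h4 : (n : ℂ) * (2 * Real.pi * I) = 0 := by
    simp only [hF, h3] at h2
    push_cast at h2
    linear_combination -h2
  have h5 := mul_eq_zero.mp h4
  exact_mod_cast h5.resolve_right two_pi_I_ne_zero

end HasWindingAtInfinity

/-- The set of points whose forward orbit under `f` meets `S`. -/
def orbitSaturation (f : ℂ → ℂ) (S : Set ℂ) : Set ℂ := {z | ∃ i : ℕ, f^[i] z ∈ S}

section Periodic

variable {f : ℂ → ℂ} {p : ℕ}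

theorem norm_iterate_sub_le {D : ℝ} (hD : ∀ z, ‖f z - z‖ ≤ D) (i : ℕ) (z : ℂ) :
    ‖f^[i] z - z‖ ≤ i * D := by
  induction i with
  | zero => simp
  | succ i ih =>
    rw [Function.iterate_succ_apply']
    calc ‖f (f^[i] z) - z‖ = ‖(f (f^[i] z) - f^[i] z) + (f^[i] z - z)‖ := by ring_nf
      _ ≤ D + i * D := (norm_add_le _ _).trans (add_le_add (hD _) ih)
      _ = (i + 1 : ℕ) * D := by push_cast; ring

theorem iterate_mod_of_periodic (hfp : ∀ z, f^[p] z = z) (i : ℕ) (z : ℂ) :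
    f^[i % p] z = f^[i] z :=
  Function.IsPeriodicPt.iterate_mod_apply (hfp z) i

theorem orbitSaturation_eq_iUnion (hp : 0 < p) (hfp : ∀ z, f^[p] z = z) (S : Set ℂ) :
    orbitSaturation f S = ⋃ i : Fin p, f^[i] ⁻¹' S := by
  ext z
  simp only [orbitSaturation, mem_ofPred_eq, mem_iUnion, mem_preimage]
  constructor
  · rintro ⟨i, hi⟩
    exact ⟨⟨i % p, Nat.mod_lt _ hp⟩, by simpa [iterate_mod_of_periodic hfp] using hi⟩
  · rintro ⟨i, hi⟩
    exact ⟨i, hi⟩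

theorem map_mem_orbitSaturation_iff (hp : 0 < p) (hfp : ∀ z, f^[p] z = z) {S : Set ℂ} {z : ℂ} :
    f z ∈ orbitSaturation f S ↔ z ∈ orbitSaturation f S := by
  constructor
  · rintro ⟨i, hi⟩
    exact ⟨i + 1, hi⟩
  · rintro ⟨i, hi⟩
    refine ⟨i + (p - 1), ?_⟩
    rwa [← Function.iterate_succ_apply f, show (i + (p - 1)).succ = i + p by omega,
      Function.iterate_add_apply, hfp]

theorem isOpen_orbitSaturation (hf : Continuous f) {S : Set ℂ} (hS : IsOpen S) :
    IsOpen (orbitSaturation f S) := by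
  have : orbitSaturation f S = ⋃ i : ℕ, f^[i] ⁻¹' S := by
    ext z
    simp [orbitSaturation]
  rw [this]
  exact isOpen_iUnion fun i => hS.preimage (hf.iterate i)

theorem prod_iterate_sub_map (hfp : ∀ z, f^[p] z = z) (b z : ℂ) :
    ∏ j ∈ Finset.range p, (f^[j] (f z) - b) = ∏ j ∈ Finset.range p, (f^[j] z - b) := by
  simp only [← Function.iterate_succ_apply f]
  rcases p with _ | p
  · rfl
  · rw [Finset.prod_range_succ, Finset.prod_range_succ', hfp, Function.iterate_zero_apply]

theorem eq_of_mem_of_mem_of_disjoint (hp : 0 < p) (hfp : ∀ z, f^[p] z = z) {B : Set ℂ}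
    (hB : ∀ z ∈ B, ∀ i, 0 < i → i < p → f^[i] z ∉ B) {z : ℂ} {i j : ℕ}
    (hi : f^[i] z ∈ B) (hj : f^[j] z ∈ B) : f^[i] z = f^[j] z := by
  wlog hij : i ≤ j generalizing i j
  · exact (this hj hi (le_of_not_ge hij)).symm
  obtain ⟨d, rfl⟩ := Nat.exists_eq_add_of_le hij
  rw [add_comm, Function.iterate_add_apply, ← iterate_mod_of_periodic hfp d] at hj ⊢
  rcases (d % p).eq_zero_or_pos with h | h
  · rw [h, Function.iterate_zero_apply]
  · exact absurd hj (hB _ hi _ h (Nat.mod_lt _ hp))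

/-- An invariant nonvanishing function on a closed invariant set `A` can be modified so that it
extends to the orbit of a disc disjoint from its translates. The winding number at infinity
changes by a multiple of the period. -/
theorem exists_invariant_extension_disc (hf : Continuous f) (hp : 0 < p)
    (hfp : ∀ z, f^[p] z = z) {D : ℝ} (hD : ∀ z, ‖f z - z‖ ≤ D) {A : Set ℂ} (hA : IsClosed A)
    (hAf : MapsTo f A A) {b : ℂ} {r : ℝ} (hr : 0 < r)
    (hB : ∀ z ∈ closedBall b r, ∀ i, 0 < i → i < p → f^[i] z ∉ closedBall b r)
    {g : ℂ → ℂ} {n : ℤ} (hg : ContinuousOn g A) (hg0 : ∀ z ∈ A, g z ≠ 0)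
    (hgf : ∀ z ∈ A, g (f z) = g z) (hgn : HasWindingAtInfinity g n) :
    ∃ (g' : ℂ → ℂ) (k : ℤ), ContinuousOn g' (A ∪ orbitSaturation f (closedBall b r)) ∧
      (∀ z ∈ A ∪ orbitSaturation f (closedBall b r), g' z ≠ 0) ∧
      (∀ z ∈ A ∪ orbitSaturation f (closedBall b r), g' (f z) = g' z) ∧
      HasWindingAtInfinity g' (n + p * k) := by
  classical
  obtain ⟨k, σ, hσ, hgσ⟩ := exists_zpow_mul_exp_of_subset_sphere (b := b) hr
    (hA.inter isClosed_sphere) inter_subset_right (hg.mono inter_subset_left)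
    (fun z hz => hg0 z hz.1)
  set B := closedBall b r with hBdef
  set N : ℂ → ℂ := fun z => ∏ j ∈ Finset.range p, (f^[j] z - b) with hN
  set N' : ℂ → ℂ := fun z => ∏ j ∈ Finset.range (p - 1), (f^[j + 1] z - b) with hN'
  have hNc : Continuous N :=
    continuous_finsetProd _ fun j _ => (hf.iterate j).sub continuous_const
  have hN'c : Continuous N' :=
    continuous_finsetProd _ fun j _ => (hf.iterate (j + 1)).sub continuous_const
  have hNN' : ∀ z, N z = N' z * (z - b) := by
    intro z
    have := Finset.prod_range_succ' (fun j => f^[j] z - b) (p - 1)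
    rwa [Nat.sub_add_cancel hp] at this
  have hbB : b ∈ B := mem_closedBall_self hr.le
  have hN'0 : ∀ z ∈ B, N' z ≠ 0 := by
    intro z hz
    refine Finset.prod_ne_zero_iff.mpr fun j hj => sub_ne_zero.mpr fun h => ?_
    have hj' := Finset.mem_range.mp hj
    exact hB z hz (j + 1) (by omega) (by omega) (h ▸ hbB)
  have hN0 : ∀ z, z ∉ orbitSaturation f (ball b r) → N z ≠ 0 := by
    intro z hz
    refine Finset.prod_ne_zero_iff.mpr fun j _ => sub_ne_zero.mpr fun h => hz ⟨j, ?_⟩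
    rw [h]
    exact mem_ball_self hr
  set e : ℂ → ℂ := fun w => exp (σ w) * N' w ^ (-k) with he
  have hec : ContinuousOn e B :=
    hσ.cexp.continuousOn.mul (hN'c.continuousOn.zpow₀ _ fun z hz => Or.inl (hN'0 z hz))
  have he0 : ∀ w ∈ B, e w ≠ 0 := fun w hw =>
    mul_ne_zero (exp_ne_zero _) (zpow_ne_zero _ (hN'0 w hw))
  set g' : ℂ → ℂ := fun z =>
    if h : z ∈ orbitSaturation f B then e (f^[h.choose] z) else g z * N z ^ (-k) with hg'
  have hin : ∀ (i : ℕ) (z : ℂ), f^[i] z ∈ B → g' z = e (f^[i] z) := by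
    intro i z hz
    have h : z ∈ orbitSaturation f B := ⟨i, hz⟩
    simp only [hg', dif_pos h]
    rw [eq_of_mem_of_mem_of_disjoint hp hfp hB h.choose_spec hz]
  have hiter : ∀ (i : ℕ), ∀ z ∈ A, f^[i] z ∈ A ∧ g (f^[i] z) = g z := by
    intro i
    induction i with
    | zero => exact fun z hz => ⟨hz, rfl⟩
    | succ i ih =>
      intro z hz
      obtain ⟨h1, h2⟩ := ih (f z) (hAf hz)
      exact ⟨h1, h2.trans (hgf z hz)⟩
  have hNiter : ∀ (i : ℕ) (z : ℂ), N (f^[i] z) = N z := by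
    intro i
    induction i with
    | zero => exact fun z => rfl
    | succ i ih => exact fun z => (ih (f z)).trans (prod_iterate_sub_map hfp b z)
  have hout : ∀ z ∈ A \ orbitSaturation f (ball b r), g' z = g z * N z ^ (-k) := by
    rintro z ⟨hzA, hz⟩
    by_cases h : z ∈ orbitSaturation f B
    · obtain ⟨i, hi⟩ := h
      obtain ⟨hwA, hwg⟩ := hiter i z hzA
      have hws : f^[i] z ∈ sphere b r := by
        rw [← closedBall_sdiff_ball]
        exact ⟨hi, fun h => hz ⟨i, h⟩⟩
      have hwb : f^[i] z - b ≠ 0 := sub_ne_zero.mpr (ne_of_mem_sphere hws hr.ne')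
      rw [hin i z hi, ← hwg, ← hNiter i z, hNN', hgσ _ ⟨hwA, hws⟩, mul_zpow]
      simp only [he, zpow_neg]
      field_simp
    · simp [hg', h]
  have hset : A ∪ orbitSaturation f B =
      (A \ orbitSaturation f (ball b r)) ∪ ⋃ i : Fin p, f^[i] ⁻¹' B := by
    rw [← orbitSaturation_eq_iUnion hp hfp]
    have : orbitSaturation f (ball b r) ⊆ orbitSaturation f B :=
      fun z ⟨i, hi⟩ => ⟨i, ball_subset_closedBall hi⟩
    ext z
    have := @this z
    simp only [mem_union, mem_sdiff]
    tauto
  have hBi : ∀ i : Fin p, IsClosed (f^[i] ⁻¹' B) :=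
    fun i => isClosed_closedBall.preimage (hf.iterate i)
  have hBsub : ⋃ i : Fin p, f^[i] ⁻¹' B ⊆ orbitSaturation f B :=
    (orbitSaturation_eq_iUnion hp hfp B).ge
  refine ⟨g', -k, ?_, ?_, ?_, ?_⟩
  · rw [hset]
    refine ContinuousOn.union_of_isClosed ?_ ?_
      (hA.sdiff (isOpen_orbitSaturation hf isOpen_ball)) (isClosed_iUnion_of_finite hBi)
    · exact ((hg.mono sdiff_subset).mul
        (hNc.continuousOn.zpow₀ _ fun z hz => Or.inl (hN0 z hz.2))).congr hout
    · refine (locallyFinite_of_finite _).continuousOn_iUnion hBi fun i => ?_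
      exact (hec.comp (hf.iterate i).continuousOn fun z hz => hz).congr fun z hz => hin i z hz
  · rw [hset]
    rintro z (hz | hz)
    · rw [hout z hz]
      exact mul_ne_zero (hg0 z hz.1) (zpow_ne_zero _ (hN0 z hz.2))
    · obtain ⟨i, hi⟩ := hBsub hz
      rw [hin i z hi]
      exact he0 _ hi
  · intro z hz
    by_cases h : z ∈ orbitSaturation f B
    · obtain ⟨i, hi⟩ := (map_mem_orbitSaturation_iff hp hfp).mpr h
      rw [hin i (f z) hi, hin (i + 1) z hi, Function.iterate_succ_apply]
    · have h' : f z ∉ orbitSaturation f B := fun h' =>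
        h ((map_mem_orbitSaturation_iff hp hfp).mp h')
      have hzA : z ∈ A := hz.resolve_right h
      simp only [hg', dif_neg h, dif_neg h', hgf z hzA]
      rw [show N (f z) = N z from hNiter 1 z]
  · have hNw : HasWindingAtInfinity N p := by
      have := HasWindingAtInfinity.prod (Finset.range p) (g := fun j z => f^[j] z - b) (n := 1)
        fun j _ => HasWindingAtInfinity.of_norm_sub_le (D := j * D + ‖b‖)
          ((hf.iterate j).sub continuous_const) fun z => by
            rw [sub_right_comm]
            exact (norm_sub_le _ _).trans (add_le_add (norm_iterate_sub_le hD j z) le_rfl)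
      simpa using this
    have hD0 : 0 ≤ D := (norm_nonneg _).trans (hD 0)
    refine (hgn.mul (hNw.zpow (-k))).congr (‖b‖ + r + p * D + 1) fun z hz => ?_
    have h : z ∉ orbitSaturation f B := by
      rw [orbitSaturation_eq_iUnion hp hfp]
      intro h
      obtain ⟨i, hi⟩ := mem_iUnion.mp h
      have h1 : ‖f^[i] z - b‖ ≤ r := mem_closedBall_iff_norm.mp hi
      have h2 := norm_iterate_sub_le hD i z
      have h3 : (i : ℝ) * D ≤ p * D :=
        mul_le_mul_of_nonneg_right (by exact_mod_cast i.2.le) hD0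
      have h4 : ‖z‖ ≤ ‖b‖ + ‖f^[i] z - b‖ + ‖f^[i] z - z‖ := by
        calc ‖z‖ = ‖b + (f^[i] z - b) - (f^[i] z - z)‖ := by ring_nf
          _ ≤ _ := (norm_sub_le _ _).trans (add_le_add (norm_add_le _ _) le_rfl)
      linarith
    simp only [hg', dif_neg h]

theorem exists_closedBall_disjoint_iterates (hf : Continuous f) (hp : p.Prime)
    (hfp : ∀ z, f^[p] z = z) {x : ℂ} (hx : f x ≠ x) :
    ∃ r > 0, ∀ z ∈ closedBall x r, ∀ i, 0 < i → i < p → f^[i] z ∉ closedBall x r := by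
  have hne : ∀ i, 0 < i → i < p → f^[i] x ≠ x := by
    intro i hi hip h
    rcases (Nat.dvd_prime hp).mp (Function.IsPeriodicPt.minimalPeriod_dvd (hfp x)) with h1 | h1
    · exact hx (Function.minimalPeriod_eq_one_iff_isFixedPt.mp h1)
    · have := Nat.le_of_dvd hi (Function.IsPeriodicPt.minimalPeriod_dvd h)
      omega
  have hW : ∀ i, ∃ W ∈ nhds x, 0 < i → i < p → ∀ z ∈ W, f^[i] z ∉ W := by
    intro i
    by_cases h : 0 < i ∧ i < p
    · obtain ⟨U, hU, V, hV, hUV⟩ := Filter.disjoint_iff.mp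
        (disjoint_nhds_nhds.mpr (hne i h.1 h.2).symm)
      exact ⟨U ∩ f^[i] ⁻¹' V, Filter.inter_mem hU ((hf.iterate i).continuousAt hV),
        fun _ _ z hz hz' => disjoint_left.mp hUV hz'.1 hz.2⟩
    · exact ⟨univ, Filter.univ_mem, fun h1 h2 => absurd ⟨h1, h2⟩ h⟩
  choose W hWx hWd using hW
  obtain ⟨r, hr, hrW⟩ := nhds_basis_closedBall.mem_iff.mp
    ((Filter.biInter_finset_mem (Finset.range p)).mpr fun i _ => hWx i)
  have hsub : ∀ i < p, closedBall x r ⊆ W i := fun i hi z hz =>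
    mem_iInter₂.mp (hrW hz) i (Finset.mem_range.mpr hi)
  exact ⟨r, hr, fun z hz i hi hip h => hWd i hi hip z (hsub i hip hz) (hsub i hip h)⟩

/-- A continuous self-map of the plane of prime period at bounded distance from the identity is the
identity. -/
theorem eq_self_of_iterate_prime (hf : Continuous f) (hp : p.Prime) (hfp : ∀ z, f^[p] z = z)
    {D : ℝ} (hD : ∀ z, ‖f z - z‖ ≤ D) (y : ℂ) : f y = y := by
  classical
  by_contra hy
  have hp0 : (p : ℂ) ≠ 0 := by exact_mod_cast hp.ne_zero
  have hD0 : 0 ≤ D := (norm_nonneg _).trans (hD 0)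
  set h : ℂ → ℂ := fun z => (∑ i ∈ Finset.range p, f^[i] z) / p with hh
  have hhc : Continuous h :=
    (continuous_finsetSum _ fun i _ => hf.iterate i).div_const _
  have hhf : ∀ z, h (f z) = h z := by
    intro z
    have h1 := Finset.sum_range_succ (fun i => f^[i] z) p
    have h2 := Finset.sum_range_succ' (fun i => f^[i] z) p
    rw [hfp] at h1
    have : ∑ i ∈ Finset.range p, f^[i] (f z) = ∑ i ∈ Finset.range p, f^[i] z :=
      add_right_cancel (h2.symm.trans h1)
    simp only [hh, this]
  have hhfix : ∀ z, f z = z → h z = z := by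
    intro z hz
    have : ∀ i, f^[i] z = z := fun i => Function.iterate_fixed hz i
    simp only [hh, this, Finset.sum_const, Finset.card_range, nsmul_eq_mul]
    field_simp
  have hhD : ∀ z, ‖h z - z‖ ≤ p * D := by
    intro z
    have e : h z - z = (∑ i ∈ Finset.range p, (f^[i] z - z)) / p := by
      simp only [hh, Finset.sum_sub_distrib, Finset.sum_const, Finset.card_range, nsmul_eq_mul]
      field_simp
    have hpR : (0 : ℝ) < p := by exact_mod_cast hp.pos
    rw [e, norm_div, norm_natCast, div_le_iff₀ hpR]
    refine (norm_sum_le _ _).trans ((Finset.sum_le_card_nsmul _ _ (p * D) fun i hi => ?_).trans ?_)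
    · refine (norm_iterate_sub_le hD i z).trans (mul_le_mul_of_nonneg_right ?_ hD0)
      exact_mod_cast (Finset.mem_range.mp hi).le
    · simp [mul_comm]
  have hC : IsCompact (h ⁻¹' {y}) := by
    refine (isCompact_closedBall y (p * D)).of_isClosed_subset
      (isClosed_singleton.preimage hhc) fun z hz => ?_
    rw [mem_closedBall_iff_norm, norm_sub_rev, ← show h z = y from hz]
    exact hhD z
  have hfree : ∀ x ∈ h ⁻¹' {y}, f x ≠ x := by
    intro x hx hfx
    have : x = y := (hhfix x hfx).symm.trans hx
    exact hy (this ▸ hfx)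
  choose! r hr hrB using fun x hx => exists_closedBall_disjoint_iterates hf hp hfp (hfree x hx)
  obtain ⟨t, htC, ht⟩ := hC.elim_nhds_subcover (fun x => ball x (r x))
    fun x hx => ball_mem_nhds x (hr x hx)
  set A : Finset ℂ → Set ℂ := fun s =>
    (orbitSaturation f (⋃ x ∈ t, ball x (r x)))ᶜ ∪
      ⋃ x ∈ s, orbitSaturation f (closedBall x (r x)) with hAdef
  have hAclosed : ∀ s, IsClosed (A s) := by
    intro s
    refine IsClosed.union (isOpen_orbitSaturation hf
      (isOpen_biUnion fun x _ => isOpen_ball)).isClosed_compl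
      (s.finite_toSet.isClosed_biUnion fun x _ => ?_)
    rw [orbitSaturation_eq_iUnion hp.pos hfp]
    exact isClosed_iUnion_of_finite fun i => isClosed_closedBall.preimage (hf.iterate i)
  have hAf : ∀ s, MapsTo f (A s) (A s) := by
    intro s z hz
    simpa only [hAdef, mem_union, mem_compl_iff, mem_iUnion,
      map_mem_orbitSaturation_iff hp.pos hfp] using hz
  have key : ∀ s ⊆ t, ∃ (g : ℂ → ℂ) (k : ℤ), ContinuousOn g (A s) ∧ (∀ z ∈ A s, g z ≠ 0) ∧
      (∀ z ∈ A s, g (f z) = g z) ∧ HasWindingAtInfinity g (1 + p * k) := by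
    intro s
    induction s using Finset.induction_on with
    | empty =>
      intro _
      refine ⟨fun z => h z - y, 0, (hhc.sub continuous_const).continuousOn, fun z hz h0 => ?_,
        fun z _ => by simp only [hhf], ?_⟩
      · have hz' : z ∉ orbitSaturation f (⋃ x ∈ t, ball x (r x)) := by simpa [hAdef] using hz
        exact hz' ⟨0, ht (sub_eq_zero.mp h0)⟩
      · simpa using HasWindingAtInfinity.of_norm_sub_le (g := fun z => h z - y)
          (hhc.sub continuous_const) (D := p * D + ‖y‖) fun z => by
            rw [sub_right_comm]
            exact (norm_sub_le _ _).trans (add_le_add (hhD z) le_rfl)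
    | insert x s _ ih =>
      intro hs
      obtain ⟨g, k, hg, hg0, hgf, hgw⟩ := ih ((Finset.subset_insert x s).trans hs)
      have hx := htC x (hs (Finset.mem_insert_self x s))
      obtain ⟨g', l, hg', hg'0, hg'f, hg'w⟩ := exists_invariant_extension_disc hf hp.pos hfp hD
        (hAclosed s) (hAf s) (hr x hx) (hrB x hx) hg hg0 hgf hgw
      have hAi : A (insert x s) = A s ∪ orbitSaturation f (closedBall x (r x)) := by
        simp only [hAdef, Finset.set_biUnion_insert]
        rw [union_assoc, union_comm (orbitSaturation f (closedBall x (r x)))]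
      rw [hAi]
      refine ⟨g', k + l, hg', hg'0, hg'f, ?_⟩
      rwa [mul_add, ← add_assoc]
  obtain ⟨g, k, hg, hg0, -, hgw⟩ := key t subset_rfl
  have hAt : A t = univ := by
    refine eq_univ_of_forall fun z => or_iff_not_imp_left.mpr fun hz => ?_
    obtain ⟨i, hi⟩ := not_not.mp hz
    obtain ⟨x, hx, hxi⟩ := mem_iUnion₂.mp hi
    exact mem_iUnion₂.mpr ⟨x, hx, i, ball_subset_closedBall hxi⟩
  rw [hAt] at hg hg0
  have h0 := hgw.eq_zero_of_forall_ne_zero (continuousOn_univ.mp hg) fun z => hg0 z (mem_univ z)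
  have hdvd : (p : ℤ) ∣ 1 := ⟨-k, by linarith⟩
  exact hp.one_lt.ne' (by exact_mod_cast Int.eq_one_of_dvd_one (by positivity) hdvd)

/-- A continuous self-map of the plane of finite order at bounded distance from the identity is the
identity. -/
theorem eq_self_of_iterate_eq_self (hf : Continuous f) {n : ℕ} (hn : 0 < n)
    (hfn : ∀ z, f^[n] z = z) {D : ℝ} (hD : ∀ z, ‖f z - z‖ ≤ D) (y : ℂ) : f y = y := by
  induction n using Nat.strong_induction_on with
  | _ n ih =>
    rcases eq_or_ne n 1 with rfl | hn1
    · exact hfn y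
    · obtain ⟨p, hp, m, rfl⟩ := Nat.exists_prime_and_dvd hn1
      have hm : 0 < m := Nat.pos_of_mul_pos_left hn
      refine ih m (lt_mul_of_one_lt_left hm hp.one_lt) hm ?_
      refine eq_self_of_iterate_prime (hf.iterate m) hp (fun z => ?_) (norm_iterate_sub_le hD m)
      rw [← Function.iterate_mul, mul_comm, hfn]

end Periodic

/-- A finite abelian group embedding into the image of `ℤ²` is a product of two cyclic groups. -/
theorem exists_addEquiv_zmod_prod_zmod {A T : Type*} [AddCommGroup A] [Finite A] [AddCommGroup T]
    (ι : A →+ T) (hι : Function.Injective ι) (θ : (Fin 2 → ℤ) →+ T)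
    (hθ : ∀ a, ι a ∈ θ.range) :
    ∃ p q : ℕ, 0 < p ∧ 0 < q ∧ Nonempty (A ≃+ ZMod p × ZMod q) := by
  let S : Submodule ℤ (Fin 2 → ℤ) := (ι.range.comap θ).toIntSubmodule
  have hS : ∀ v : S, ∃ a, ι a = θ v := fun v => v.2
  choose ρ hρ using hS
  let r : S →ₗ[ℤ] A := (AddMonoidHom.mk' ρ fun v w => hι (by simp [hρ])).toIntLinearMap
  have hr : Function.Surjective r := by
    intro a
    obtain ⟨v, hv⟩ := hθ a
    exact ⟨⟨v, a, hv.symm⟩, hι ((hρ _).trans hv)⟩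
  have hk : Module.finrank ℤ S ≤ 2 := by simpa using S.finrank_le
  let e := (Module.finBasis ℤ S).equivFun.symm
  let π : (Fin 2 → ℤ) →ₗ[ℤ] A :=
    r ∘ₗ e.toLinearMap ∘ₗ LinearMap.funLeft ℤ ℤ (Fin.castLE hk)
  have hπ : Function.Surjective π :=
    hr.comp (e.surjective.comp (LinearMap.funLeft_surjective_of_injective ℤ ℤ _
      (Fin.castLE_injective hk)))
  have hfin : Finite ((Fin 2 → ℤ) ⧸ LinearMap.ker π) :=
    Finite.of_equiv A (π.quotKerEquivOfSurjective hπ).symm.toEquiv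
  have hrank := (Submodule.finiteQuotient_iff _).mp hfin
  refine ⟨_, _, ?_, ?_, ⟨(π.quotKerEquivOfSurjective hπ).symm.toAddEquiv.trans
    (((LinearMap.ker π).quotientEquivPiZMod (Pi.basisFun ℤ (Fin 2)) hrank).trans
      (RingEquiv.piFinTwo _).toAddEquiv)⟩⟩
  · exact Int.natAbs_pos.mpr (Submodule.smithNormalFormCoeffs_ne_zero _ hrank 0)
  · exact Int.natAbs_pos.mpr (Submodule.smithNormalFormCoeffs_ne_zero _ hrank 1)

/-- The universal covering of the torus, as a homomorphism from the complex plane. -/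
def torusProj : ℂ →+ Torus2 where
  toFun z := (z.re, z.im)
  map_zero' := by simp
  map_add' z w := by simp

theorem torusProj_apply (z : ℂ) : torusProj z = ((z.re : AddCircle (1 : ℝ)), ↑z.im) := rfl

theorem continuous_torusProj : Continuous torusProj :=
  ((AddCircle.continuous_mk' 1).comp continuous_re).prodMk
    ((AddCircle.continuous_mk' 1).comp continuous_im)

theorem torusProj_surjective : Function.Surjective torusProj := by
  rintro ⟨x, y⟩
  obtain ⟨a, rfl⟩ := QuotientAddGroup.mk_surjective x
  obtain ⟨b, rfl⟩ := QuotientAddGroup.mk_surjective y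
  exact ⟨⟨a, b⟩, rfl⟩

theorem torusProj_eq_zero_iff {z : ℂ} :
    torusProj z = 0 ↔ ∃ m n : ℤ, z = m + n * I := by
  rw [torusProj_apply, Prod.mk_eq_zero, AddCircle.coe_eq_zero_iff, AddCircle.coe_eq_zero_iff]
  constructor
  · rintro ⟨⟨m, hm⟩, n, hn⟩
    exact ⟨m, n, Complex.ext (by simpa using hm.symm) (by simpa using hn.symm)⟩
  · rintro ⟨m, n, rfl⟩
    exact ⟨⟨m, by simp⟩, n, by simp⟩

/-- A map to the circle homotopic to a constant lifts to the line. -/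
theorem exists_lift_of_homotopic_zero {X : Type*} [TopologicalSpace X]
    {f : C(X, AddCircle (1 : ℝ))} (hf : (ContinuousMap.const X 0).Homotopic f) :
    ∃ F : C(X, ℝ), ∀ x, (F x : AddCircle (1 : ℝ)) = f x := by
  obtain ⟨H⟩ := hf
  have cov := AddCircle.isCoveringMap_coe (1 : ℝ)
  have h0 : ∀ a, H.toContinuousMap (0, a) = ((ContinuousMap.const X (0 : ℝ) a : ℝ) :
      AddCircle (1 : ℝ)) := fun a => (H.apply_zero a).trans (by simp)
  refine ⟨⟨fun x => cov.liftHomotopy H.toContinuousMap (.const X 0) h0 (1, x), by fun_prop⟩,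
    fun x => ?_⟩
  exact (congr_fun (cov.liftHomotopy_lifts H.toContinuousMap (.const X 0) h0) (1, x)).trans
    (H.apply_one x)

/-- A self-map of the torus homotopic to the identity has a displacement function. -/
theorem exists_displacement_of_homotopic_id {f : C(Torus2, Torus2)}
    (hf : f.Homotopic (ContinuousMap.id Torus2)) :
    ∃ δ : Torus2 → ℂ, Continuous δ ∧ ∀ x, f x = x + torusProj (δ x) := by
  obtain ⟨H⟩ := hf.symm
  have h1 : (ContinuousMap.const Torus2 (0 : AddCircle (1 : ℝ))).Homotopic
      ⟨fun x => (f x).1 - x.1, by fun_prop⟩ :=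
    ⟨{ toFun := fun q => (H q).1 - q.2.1
       continuous_toFun := by fun_prop
       map_zero_left := fun x => by simp
       map_one_left := fun x => by simp }⟩
  have h2 : (ContinuousMap.const Torus2 (0 : AddCircle (1 : ℝ))).Homotopic
      ⟨fun x => (f x).2 - x.2, by fun_prop⟩ :=
    ⟨{ toFun := fun q => (H q).2 - q.2.2
       continuous_toFun := by fun_prop
       map_zero_left := fun x => by simp
       map_one_left := fun x => by simp }⟩
  obtain ⟨F₁, hF₁⟩ := exists_lift_of_homotopic_zero h1
  obtain ⟨F₂, hF₂⟩ := exists_lift_of_homotopic_zero h2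
  refine ⟨fun x => F₁ x + F₂ x * I, by fun_prop, fun x => ?_⟩
  rw [torusProj_apply]
  ext <;> simp [hF₁, hF₂]

theorem eq_of_forall_torusProj_eq_zero {X : Type*} [TopologicalSpace X] [PreconnectedSpace X]
    {ψ : X → ℂ} (hψ : Continuous ψ) (h : ∀ x, torusProj (ψ x) = 0) (x y : X) : ψ x = ψ y := by
  have cov := AddCircle.isCoveringMap_coe (1 : ℝ)
  have h' : ∀ x, ((ψ x).re : AddCircle (1 : ℝ)) = 0 ∧ ((ψ x).im : AddCircle (1 : ℝ)) = 0 :=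
    fun x => Prod.mk_eq_zero.mp (h x)
  apply Complex.ext
  · exact congr_fun (cov.eq_of_comp_eq (continuous_re.comp hψ) (g₂ := fun _ => (ψ y).re)
      continuous_const (funext fun x => (h' x).1.trans (h' y).1.symm) y rfl) x
  · exact congr_fun (cov.eq_of_comp_eq (continuous_im.comp hψ) (g₂ := fun _ => (ψ y).im)
      continuous_const (funext fun x => (h' x).2.trans (h' y).2.symm) y rfl) x

/-- A finite group acting effectively on the torus by homeomorphisms homotopic to the identity
embeds into the torus: averaging the displacements semiconjugates the action to translations. -/
theorem exists_injective_hom_torus (G : Type*) [Group G] [Finite G]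
    (φ : G →* (Torus2 ≃ₜ Torus2)) (heff : Function.Injective φ)
    (hhtpy : ∀ g : G,
      ContinuousMap.Homotopic ⟨φ g, (φ g).continuous⟩ (ContinuousMap.id Torus2)) :
    ∃ ρ : G →* Multiplicative Torus2, Function.Injective ρ := by
  have := Fintype.ofFinite G
  choose δ hδc hδ using fun g => exists_displacement_of_homotopic_id (hhtpy g)
  replace hδ : ∀ g x, φ g x = x + torusProj (δ g x) := hδ
  have hmul : ∀ g h x, φ (g * h) x = φ g (φ h x) := fun g h x => by rw [map_mul]; rfl
  set c : G → G → Torus2 → ℂ := fun g h x => δ g (φ h x) + δ h x - δ (g * h) x with hc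
  have hcP : ∀ g h x, torusProj (c g h x) = 0 := by
    intro g h x
    have h1 := hmul g h x
    have h2 := hδ h x
    rw [hδ (g * h) x, hδ g (φ h x)] at h1
    rw [← sub_eq_iff_eq_add'] at h2
    rw [← eq_sub_iff_add_eq'] at h1
    rw [hc, map_sub, map_add, h1, ← h2]
    abel
  have hcc : ∀ g h x y, c g h x = c g h y := by
    intro g h
    refine eq_of_forall_torusProj_eq_zero ?_ (hcP g h)
    exact (((hδc g).comp (φ h).continuous).add (hδc h)).sub (hδc (g * h))
  set N : ℂ := (Fintype.card G : ℂ) with hN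
  have hN0 : N ≠ 0 := by simp [hN]
  set u : Torus2 → ℂ := fun x => (∑ g, δ g x) / N with hu
  have huφ : ∀ h x, u (φ h x) + δ h x - u x = (∑ g, c g h x) / N := by
    intro h x
    have : ∑ g, δ (g * h) x = ∑ g, δ g x := Equiv.sum_comp (Equiv.mulRight h) fun g => δ g x
    simp only [hu, hc, Finset.sum_sub_distrib, Finset.sum_add_distrib, Finset.sum_const,
      Finset.card_univ, nsmul_eq_mul, this, ← hN]
    field_simp
  set ρ : G → ℂ := fun h => (∑ g, c g h 0) / N with hρ
  have huρ : ∀ h x, u (φ h x) + δ h x - u x = ρ h := by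
    intro h x
    rw [huφ, hρ]
    simp only [hcc _ h x 0]
  have hρmul : ∀ g h, ρ (g * h) = ρ g + ρ h - c g h 0 := by
    intro g h
    rw [← huρ (g * h) 0, ← huρ g (φ h 0), ← huρ h 0, hmul]
    simp only [hc]
    ring
  let ρ' : G →* Multiplicative Torus2 := MonoidHom.mk'
    (fun g => Multiplicative.ofAdd (torusProj (ρ g))) fun g h => by
      rw [hρmul, map_sub, map_add, hcP, sub_zero, ofAdd_add]
  refine ⟨ρ', (injective_iff_map_eq_one ρ').mpr fun h hh => ?_⟩
  have hρ0 : torusProj (ρ h) = 0 := Multiplicative.ofAdd.injective hh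
  set F : ℂ → ℂ := fun z => z + δ h (torusProj z) - ρ h with hF
  have hFc : Continuous F :=
    (continuous_id.add ((hδc h).comp continuous_torusProj)).sub continuous_const
  have hFP : ∀ z, torusProj (F z) = φ h (torusProj z) := by
    intro z
    rw [hF, map_sub, map_add, hρ0, sub_zero, hδ]
  have hFu : ∀ z, F z + u (torusProj (F z)) = z + u (torusProj z) := by
    intro z
    rw [hFP, hF]
    linear_combination huρ h (torusProj z)
  have hiter : ∀ (n : ℕ) z, torusProj (F^[n] z) = φ (h ^ n) (torusProj z) ∧
      F^[n] z + u (torusProj (F^[n] z)) = z + u (torusProj z) := by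
    intro n
    induction n with
    | zero => intro z; simp
    | succ n ih =>
      intro z
      obtain ⟨h1, h2⟩ := ih (F z)
      rw [Function.iterate_succ_apply]
      exact ⟨by rw [h1, hFP, pow_succ, hmul], h2.trans (hFu z)⟩
  have hFn : ∀ z, F^[Fintype.card G] z = z := by
    intro z
    obtain ⟨h1, h2⟩ := hiter (Fintype.card G) z
    rw [pow_card_eq_one, map_one] at h1
    rw [show torusProj (F^[Fintype.card G] z) = torusProj z from h1] at h2
    exact add_right_cancel h2
  obtain ⟨D, hD⟩ : ∃ D, ∀ z, ‖F z - z‖ ≤ D := by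
    obtain ⟨D, hD⟩ := (isCompact_range
      ((hδc h).sub (continuous_const (y := ρ h)))).isBounded.exists_norm_le
    refine ⟨D, fun z => ?_⟩
    have : F z - z = δ h (torusProj z) - ρ h := by rw [hF]; ring
    rw [this]
    exact hD _ ⟨torusProj z, rfl⟩
  have hFid := eq_self_of_iterate_eq_self hFc Fintype.card_pos hFn hD
  refine heff ?_
  rw [map_one]
  refine Homeomorph.ext fun x => ?_
  obtain ⟨z, rfl⟩ := torusProj_surjective x
  rw [← hFP, hFid]
  rfl

/-- A finite group acting effectively by homeomorphisms on the 2-torus, with every element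
acting by a homeomorphism homotopic to the identity (i.e. trivially on `H₁(T²,ℤ)`),
is isomorphic to `ℤ/p × ℤ/q` for some positive integers `p`, `q`. -/
theorem stmt1 (G : Type*) [Group G] [Finite G]
    (φ : G →* (Torus2 ≃ₜ Torus2))
    (heff : Function.Injective φ)
    (hhtpy : ∀ g : G,
      ContinuousMap.Homotopic ⟨φ g, (φ g).continuous⟩ (ContinuousMap.id Torus2)) :
    ∃ p q : ℕ, 0 < p ∧ 0 < q ∧
      Nonempty (G ≃* Multiplicative (ZMod p) × Multiplicative (ZMod q)) := by
  obtain ⟨ρ, hρ⟩ := exists_injective_hom_torus G φ heff hhtpy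
  set N : ℕ := Nat.card G with hN
  have hN0 : (N : ℂ) ≠ 0 := by exact_mod_cast Nat.card_pos.ne'
  let ι : Additive ρ.range →+ Torus2 := ρ.range.subtype.toAdditiveLeft
  have hι : Function.Injective ι := fun a b h => Subtype.ext h
  let θ : (Fin 2 → ℤ) →+ Torus2 := torusProj.comp
    (AddMonoidHom.mk' (fun v => ((v 0 : ℂ) + v 1 * I) / N) fun v w => by
      simp only [Pi.add_apply, Int.cast_add]
      ring)
  have hθ : ∀ a, ι a ∈ θ.range := by
    rintro ⟨_, g, rfl⟩
    obtain ⟨z, hz⟩ := torusProj_surjective (ρ g).toAdd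
    have h1 : torusProj (N * z) = 0 := by
      rw [← nsmul_eq_mul, map_nsmul, hz, ← toAdd_pow, ← map_pow, hN, pow_card_eq_one', map_one]
      rfl
    obtain ⟨m, n, hmn⟩ := torusProj_eq_zero_iff.mp h1
    refine ⟨![m, n], ?_⟩
    change torusProj (((m : ℂ) + n * I) / N) = (ρ g).toAdd
    rw [← hmn, mul_div_cancel_left₀ _ hN0, hz]
  have : Finite (Additive ρ.range) := Finite.of_surjective _ ρ.rangeRestrict_surjective
  obtain ⟨p, q, hp, hq, ⟨e⟩⟩ := exists_addEquiv_zmod_prod_zmod ι hι θ hθ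
  exact ⟨p, q, hp, hq, ⟨(MonoidHom.ofInjective hρ).trans
    ((AddEquiv.toMultiplicativeRight e).trans (MulEquiv.prodMultiplicative _ _))⟩⟩
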